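/- If θ = 1/2, then there exist constants A' > 0, a > 0 and T ≥ 0 such that |Q(x(t)) − Q*| ≤ A'·e^{−a·β·t} for all t > T, where Q* = Q(z). -/

import Mathlib

open Set Metric Filter

/-- Exponential decay from the differential inequality `g' ≤ -c g` on `[0, ∞)`. -/
theorem le_mul_exp_neg_of_hasDerivAt_le {g g' : ℝ → ℝ} {c : ℝ}
    (hg : ∀ t ≥ (0 : ℝ), HasDerivAt g (g' t) t) (hle : ∀ t ≥ (0 : ℝ), g' t ≤ -c * g t)
    {t : ℝ} (ht : 0 ≤ t) : g t ≤ g 0 * Real.exp (-(c * t)) := by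
  have hderiv : ∀ s ≥ (0 : ℝ), HasDerivAt (fun s => g s * Real.exp (c * s))
      (g' s * Real.exp (c * s) + g s * (Real.exp (c * s) * c)) s := fun s hs =>
    (hg s hs).mul (by simpa using ((hasDerivAt_id s).const_mul c).exp)
  have hanti : AntitoneOn (fun s => g s * Real.exp (c * s)) (Ici 0) := by
    refine antitoneOn_of_hasDerivWithinAt_nonpos (convex_Ici 0)
      (fun s hs => (hderiv s hs).continuousAt.continuousWithinAt)
      (fun s hs => (hderiv s (interior_subset hs)).hasDerivWithinAt) fun s hs => ?_
    nlinarith [hle s (interior_subset hs), Real.exp_pos (c * s)]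
  have h := hanti self_mem_Ici (mem_Ici.2 ht) ht
  simp only [mul_zero, Real.exp_zero, mul_one] at h
  rw [Real.exp_neg, ← div_eq_mul_inv]
  exact (le_div_iff₀ (Real.exp_pos _)).2 h

/-- Along a gradient flow the function decreases at rate `‖∇f‖²`. -/
theorem hasDerivAt_comp_gradient_flow {E : Type*} [NormedAddCommGroup E] [InnerProductSpace ℝ E]
    [CompleteSpace E] {f : E → ℝ} {x : ℝ → E} {t : ℝ} (hf : DifferentiableAt ℝ f (x t))
    (hx : HasDerivAt x (-(gradient f (x t))) t) :
    HasDerivAt (fun s => f (x s)) (-‖gradient f (x t)‖ ^ 2) t := by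
  have h := hf.hasGradientAt.hasFDerivAt.comp_hasDerivAt t hx
  rwa [InnerProductSpace.toDual_apply_apply, inner_neg_right, real_inner_self_eq_norm_sq] at h

/-- If the Łojasiewicz inequalities hold with exponent `θ = 1/2` on a neighbourhood `V`
of `x*` and `Q` is `β`-Hölder continuous on `U`, then along a gradient flow `x(t)`
remaining in `V` and converging to a point `z ∈ Z` (with eventually
`‖x(t) − z‖ = d(x(t), Z)`) one has `|Q(x(t)) − Q*| ≤ A'·e^{−a·β·t}` for all `t > T`,
where `Q* = Q(z)`, for some constants `A' > 0`, `a > 0` and `T ≥ 0`. -/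
theorem holder_measurement_exponential_convergence {d : ℕ}
    (U : Set (EuclideanSpace ℝ (Fin d))) (hU : IsOpen U)
    (f : EuclideanSpace ℝ (Fin d) → ℝ) (hf : ContDiffOn ℝ 1 f U)
    (xstar : EuclideanSpace ℝ (Fin d)) (hxstar : xstar ∈ U)
    (hmin : ∀ x ∈ U, f xstar ≤ f x)
    (θ C C' : ℝ) (hθ : θ ∈ Set.Ico (1 / 2 : ℝ) 1) (hC : 0 < C) (hC' : 0 < C')
    (V : Set (EuclideanSpace ℝ (Fin d))) (hV : IsOpen V) (hxV : xstar ∈ V) (hVU : V ⊆ U)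
    (hloj₁ : ∀ x ∈ V, C * |f x - f xstar| ^ θ ≤ ‖gradient f x‖)
    (hloj₂ : ∀ x ∈ V,
      C' * (infDist x {y ∈ U | f y = f xstar}) ^ (1 / (1 - θ)) ≤ |f x - f xstar|)
    (x : ℝ → EuclideanSpace ℝ (Fin d))
    (hflow : ∀ t ≥ (0 : ℝ), HasDerivAt x (-(gradient f (x t))) t)
    (hxinV : ∀ t ≥ (0 : ℝ), x t ∈ V)
    (β : ℝ) (hβ : β ∈ Set.Ioc (0 : ℝ) 1)
    (Q : EuclideanSpace ℝ (Fin d) → ℝ) (K : ℝ) (hK : 0 < K)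
    (hQ : ∀ y ∈ U, ∀ y' ∈ U, |Q y - Q y'| ≤ K * ‖y - y'‖ ^ β)
    (z : EuclideanSpace ℝ (Fin d)) (hz : z ∈ {y ∈ U | f y = f xstar})
    (hconv : Tendsto x atTop (nhds z))
    (T₀ : ℝ) (hT₀ : 0 ≤ T₀)
    (hdist : ∀ t > T₀, ‖x t - z‖ = infDist (x t) {y ∈ U | f y = f xstar})
    (hθhalf : θ = 1 / 2) :
    ∃ A' > (0 : ℝ), ∃ a > (0 : ℝ), ∃ T ≥ (0 : ℝ), ∀ t > T,
      |Q (x t) - Q z| ≤ A' * Real.exp (-a * β * t) := by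
  subst hθhalf
  have hpow : (1 : ℝ) / (1 - 1 / 2) = (2 : ℕ) := by norm_num
  have hdecay : ∀ t ≥ (0 : ℝ),
      f (x t) - f xstar ≤ (f (x 0) - f xstar) * Real.exp (-(C ^ 2 * t)) := by
    intro t ht
    refine le_mul_exp_neg_of_hasDerivAt_le (g := fun t => f (x t) - f xstar)
      (g' := fun t => -‖gradient f (x t)‖ ^ 2) (fun s hs => ?_) (fun s hs => ?_) ht
    · have hd : DifferentiableAt ℝ f (x s) :=
        (hf.differentiableOn one_ne_zero).differentiableAt (hU.mem_nhds (hVU (hxinV s hs)))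
      exact (hasDerivAt_comp_gradient_flow hd (hflow s hs)).sub_const _
    · have h0 : 0 ≤ f (x s) - f xstar := sub_nonneg.2 (hmin _ (hVU (hxinV s hs)))
      have h1 := hloj₁ _ (hxinV s hs)
      rw [abs_of_nonneg h0, ← Real.sqrt_eq_rpow] at h1
      have h2 := pow_le_pow_left₀ (by positivity) h1 2
      rw [mul_pow, Real.sq_sqrt h0] at h2
      linarith
  set s := Real.sqrt ((f (x 0) - f xstar) / C') + 1
  have hs : 0 < s := by positivity
  have hdist_decay : ∀ t > T₀, ‖x t - z‖ ≤ s * Real.exp (-(C ^ 2 / 2 * t)) := by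
    intro t ht
    have ht0 : 0 ≤ t := hT₀.trans ht.le
    have h2 := hloj₂ _ (hxinV t ht0)
    rw [hpow, Real.rpow_natCast, ← hdist t ht,
      abs_of_nonneg (sub_nonneg.2 (hmin _ (hVU (hxinV t ht0))))] at h2
    have h0 : 0 ≤ (f (x 0) - f xstar) / C' :=
      div_nonneg (sub_nonneg.2 (hmin _ (hVU (hxinV 0 le_rfl)))) hC'.le
    have hs2 : (f (x 0) - f xstar) / C' ≤ s ^ 2 := by
      nlinarith [Real.sq_sqrt h0, Real.sqrt_nonneg ((f (x 0) - f xstar) / C')]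
    have hexp : Real.exp (-(C ^ 2 * t)) = Real.exp (-(C ^ 2 / 2 * t)) ^ 2 := by
      rw [← Real.exp_nat_mul]
      push_cast
      ring_nf
    refine (sq_le_sq₀ (norm_nonneg _) (by positivity)).1 ?_
    calc ‖x t - z‖ ^ 2
        ≤ (f (x 0) - f xstar) * Real.exp (-(C ^ 2 * t)) / C' := by
          rw [le_div_iff₀ hC', mul_comm]
          exact h2.trans (hdecay t ht0)
      _ = (f (x 0) - f xstar) / C' * Real.exp (-(C ^ 2 / 2 * t)) ^ 2 := by rw [hexp]; ring
      _ ≤ (s * Real.exp (-(C ^ 2 / 2 * t))) ^ 2 := by rw [mul_pow]; gcongr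
  refine ⟨K * s ^ β, by positivity, C ^ 2 / 2, by positivity, T₀, hT₀, fun t ht => ?_⟩
  calc |Q (x t) - Q z|
      ≤ K * ‖x t - z‖ ^ β := hQ _ (hVU (hxinV t (hT₀.trans ht.le))) _ hz.1
    _ ≤ K * (s * Real.exp (-(C ^ 2 / 2 * t))) ^ β := by
        gcongr
        · exact hβ.1.le
        · exact hdist_decay t ht
    _ = K * s ^ β * Real.exp (-(C ^ 2 / 2) * β * t) := by
        rw [Real.mul_rpow hs.le (Real.exp_pos _).le, ← Real.exp_mul]
        ring_nf
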